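/- For every ε > 0 and every p ∈ ℝ, the function x ↦ e^{−ipx} (x − iε)^{−2} is Lebesgue (Bochner) integrable on ℝ, and ∫_ℝ e^{−ipx} (x − iε)^{−2} dx = 2π p e^{εp} if p ≤ 0, while ∫_ℝ e^{−ipx} (x − iε)^{−2} dx = 0 if p ≥ 0. -/

import Mathlib

open MeasureTheory
open Set Filter Topology FourierTransform

/-- The function `s ↦ s e^{-εs}` on the positive half-line, extended by zero. -/
noncomputable def rampExp (ε : ℝ) (s : ℝ) : ℂ := ((max s 0 * Real.exp (-ε * s) : ℝ) : ℂ)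

lemma continuous_rampExp (ε : ℝ) : Continuous (rampExp ε) := by
  unfold rampExp
  fun_prop

lemma rampExp_eq_indicator (ε : ℝ) :
    rampExp ε = (Ioi 0).indicator fun s : ℝ => ((s * Real.exp (-ε * s) : ℝ) : ℂ) := by
  ext s
  by_cases hs : 0 < s
  · simp [rampExp, hs, max_eq_left hs.le]
  · simp [rampExp, hs, max_eq_right (not_lt.mp hs)]

lemma integrableOn_mul_exp_neg_mul {ε : ℝ} (hε : 0 < ε) :
    IntegrableOn (fun s : ℝ => s * Real.exp (-ε * s)) (Ioi 0) := by
  simpa using integrableOn_rpow_mul_exp_neg_mul_rpow (p := 1) (s := 1) (by norm_num)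
    one_pos hε

lemma integrable_rampExp {ε : ℝ} (hε : 0 < ε) : Integrable (rampExp ε) := by
  rw [rampExp_eq_indicator, integrable_indicator_iff measurableSet_Ioi]
  exact (integrableOn_mul_exp_neg_mul hε).ofReal

lemma integral_Ioi_mul_cexp_neg_mul {a : ℂ} (ha : 0 < a.re) :
    ∫ s in Ioi (0 : ℝ), (s : ℂ) * Complex.exp (-a * s) = (a ^ 2)⁻¹ := by
  have ha0 : a ≠ 0 := by
    rintro rfl
    simp at ha
  have hnorm (s : ℝ) : ‖Complex.exp (-a * s)‖ = Real.exp (-a.re * s) := by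
    simp [Complex.norm_exp]
  have hderiv (s : ℝ) : HasDerivAt
      (fun s : ℝ => -((s : ℂ) / a + (a ^ 2)⁻¹) * Complex.exp (-a * s))
      ((s : ℂ) * Complex.exp (-a * s)) s := by
    have hid : HasDerivAt (fun s : ℝ => (s : ℂ)) 1 s := Complex.ofRealCLM.hasDerivAt
    convert! (((hid.div_const a).add_const ((a ^ 2)⁻¹)).neg).mul ((hid.const_mul (-a)).cexp) using 1
    simp only [Pi.neg_apply]
    field_simp
    ring
  have hint : IntegrableOn (fun s : ℝ => (s : ℂ) * Complex.exp (-a * s)) (Ioi 0) := by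
    refine (integrableOn_mul_exp_neg_mul ha).mono' (by fun_prop) ?_
    filter_upwards [ae_restrict_mem measurableSet_Ioi] with s hs
    rw [norm_mul, hnorm, Complex.norm_real, Real.norm_of_nonneg (le_of_lt hs)]
  have hexp : Tendsto (fun s : ℝ => Complex.exp (-a * s)) atTop (𝓝 0) := by
    rw [tendsto_zero_iff_norm_tendsto_zero]
    simp_rw [hnorm]
    simpa using tendsto_rpow_mul_exp_neg_mul_atTop_nhds_zero 0 a.re ha
  have hmul : Tendsto (fun s : ℝ => (s : ℂ) * Complex.exp (-a * s)) atTop (𝓝 0) := by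
    rw [tendsto_zero_iff_norm_tendsto_zero]
    have h := (tendsto_rpow_mul_exp_neg_mul_atTop_nhds_zero 1 a.re ha).norm
    simp_rw [norm_mul, hnorm]
    simpa using h
  have hlim : Tendsto (fun s : ℝ => -((s : ℂ) / a + (a ^ 2)⁻¹) * Complex.exp (-a * s))
      atTop (𝓝 0) := by
    have h := (hmul.const_mul (-a⁻¹)).sub (hexp.const_mul ((a ^ 2)⁻¹))
    simp only [mul_zero, sub_zero] at h
    refine h.congr fun s => ?_
    ring
  rw [integral_Ioi_of_hasDerivAt_of_tendsto' (fun s _ => hderiv s) hint hlim]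
  simp

lemma fourier_rampExp {ε : ℝ} (hε : 0 < ε) (w : ℝ) :
    𝓕 (rampExp ε) w = -((((2 * Real.pi * w : ℝ) : ℂ) - Complex.I * ε) ^ 2)⁻¹ := by
  rw [Real.fourier_real_eq_integral_exp_smul, rampExp_eq_indicator]
  have ha : 0 < ((ε : ℂ) + Complex.I * ((2 * Real.pi * w : ℝ) : ℂ)).re := by
    simpa using hε
  have h := integral_Ioi_mul_cexp_neg_mul ha
  rw [← integral_indicator measurableSet_Ioi] at h
  have hsq : ((ε : ℂ) + Complex.I * ((2 * Real.pi * w : ℝ) : ℂ)) ^ 2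
      = -((((2 * Real.pi * w : ℝ) : ℂ) - Complex.I * ε) ^ 2) := by
    linear_combination (((2 * Real.pi * w : ℝ) : ℂ) ^ 2 + (ε : ℂ) ^ 2) * Complex.I_sq
  rw [hsq, inv_neg] at h
  rw [← h]
  congr 1
  ext s
  by_cases hs : s ∈ Ioi (0 : ℝ)
  · simp only [indicator_of_mem hs, smul_eq_mul]
    push_cast
    rw [mul_left_comm, ← Complex.exp_add]
    congr 2
    ring
  · simp [indicator_of_notMem hs]

lemma ofReal_sub_I_mul_ne_zero {ε : ℝ} (hε : 0 < ε) (x : ℝ) :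
    (x : ℂ) - Complex.I * ε ≠ 0 := fun h => by
  have := congrArg Complex.im h
  simp at this
  exact hε.ne' this

lemma integrable_inv_sub_I_mul_sq {ε : ℝ} (hε : 0 < ε) :
    Integrable fun x : ℝ => (((x : ℂ) - Complex.I * ε) ^ 2)⁻¹ := by
  have hbound : Integrable fun x : ℝ => (ε ^ 2)⁻¹ * (1 + (ε⁻¹ * x) ^ 2)⁻¹ :=
    (integrable_inv_one_add_sq.comp_mul_left' (inv_ne_zero hε.ne')).const_mul _
  refine hbound.mono' (Continuous.aestronglyMeasurable ?_) (ae_of_all _ fun x => le_of_eq ?_)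
  · exact Continuous.inv₀ (by fun_prop) fun x => pow_ne_zero 2 (ofReal_sub_I_mul_ne_zero hε x)
  · rw [norm_inv, norm_pow, ← Complex.normSq_eq_norm_sq, Complex.normSq_apply, ← mul_inv]
    congr 1
    simp
    field_simp
    ring

lemma integral_cexp_mul_inv_sub_I_mul_sq {ε : ℝ} (hε : 0 < ε) (p : ℝ) :
    ∫ x : ℝ, Complex.exp (-(Complex.I * (p : ℂ) * (x : ℂ))) *
      (((x : ℂ) - Complex.I * (ε : ℂ)) ^ 2)⁻¹ = -(2 * Real.pi * rampExp ε (-p)) := by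
  have hpi : (0 : ℝ) < 2 * Real.pi := Real.two_pi_pos
  have hF : 𝓕 (rampExp ε) = fun w : ℝ =>
      -((((2 * Real.pi * w : ℝ) : ℂ) - Complex.I * ε) ^ 2)⁻¹ := funext (fourier_rampExp hε)
  have hFint : Integrable (𝓕 (rampExp ε)) := by
    rw [hF]
    exact ((integrable_inv_sub_I_mul_sq hε).comp_mul_left' hpi.ne').neg
  have hinv := congrFun
    ((continuous_rampExp ε).fourierInv_fourier_eq (integrable_rampExp hε) hFint) (-p)
  rw [Real.fourierInv_eq', hF] at hinv
  have hscale := Measure.integral_comp_mul_left (fun x : ℝ =>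
    Complex.exp (-(Complex.I * (p : ℂ) * (x : ℂ))) *
      (((x : ℂ) - Complex.I * (ε : ℂ)) ^ 2)⁻¹) (2 * Real.pi)
  have hneg : ∫ w : ℝ, Complex.exp (-(Complex.I * (p : ℂ) * ((2 * Real.pi * w : ℝ) : ℂ))) *
      ((((2 * Real.pi * w : ℝ) : ℂ) - Complex.I * (ε : ℂ)) ^ 2)⁻¹ = -rampExp ε (-p) := by
    rw [← hinv, ← integral_neg]
    congr 1
    ext w
    rw [smul_eq_mul, mul_neg, neg_neg]
    congr 2
    simp
    ring
  rw [hneg, abs_of_pos (inv_pos.mpr hpi), Complex.real_smul] at hscale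
  have hpi' : (Real.pi : ℂ) ≠ 0 := Complex.ofReal_ne_zero.mpr Real.pi_ne_zero
  rw [← mul_neg, hscale]
  push_cast
  field_simp

/-- Fourier transform of the regularized horizon vacuum kernel `(x - iε)⁻²`:
for every `ε > 0` and `p ∈ ℝ`, the function `x ↦ e^{-ipx} (x - iε)⁻²` is integrable on
`ℝ`, its integral equals `2π p e^{εp}` for `p ≤ 0` and vanishes for `p ≥ 0`
(positive-frequency support of the horizon vacuum). -/
theorem stmt_2 (ε p : ℝ) (hε : 0 < ε) :
    Integrable (fun x : ℝ =>
      Complex.exp (-(Complex.I * (p : ℂ) * (x : ℂ))) * (((x : ℂ) - Complex.I * (ε : ℂ)) ^ 2)⁻¹) ∧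
    (p ≤ 0 →
      ∫ x : ℝ, Complex.exp (-(Complex.I * (p : ℂ) * (x : ℂ))) *
          (((x : ℂ) - Complex.I * (ε : ℂ)) ^ 2)⁻¹
        = ((2 * Real.pi * p * Real.exp (ε * p) : ℝ) : ℂ)) ∧
    (0 ≤ p →
      ∫ x : ℝ, Complex.exp (-(Complex.I * (p : ℂ) * (x : ℂ))) *
          (((x : ℂ) - Complex.I * (ε : ℂ)) ^ 2)⁻¹
        = 0) := by
  refine ⟨?_, fun hp => ?_, fun hp => ?_⟩
  · refine (integrable_inv_sub_I_mul_sq hε).bdd_mul (c := 1) (by fun_prop)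
      (ae_of_all _ fun x => le_of_eq ?_)
    simp [Complex.norm_exp]
  · rw [integral_cexp_mul_inv_sub_I_mul_sq hε, rampExp, max_eq_left (neg_nonneg.mpr hp)]
    push_cast
    ring_nf
  · rw [integral_cexp_mul_inv_sub_I_mul_sq hε, rampExp, max_eq_right (neg_nonpos.mpr hp)]
    simp
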